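/- Uniform n-scale estimate for the regularized corrector equation (Theorem 3.4): Let n ≥ 2, d ≥ 1, λ ∈ (0,1], C₀ ≥ 1, Λ₀, Λ₁ > 0. There exist constants C̃ⱼ ≥ 1 (for 2 ≤ j ≤ n), Cₙ ≥ 1 — depending only on d, λ, j, n, C₀ — and Λ̃ⱼ ≥ 1 (for 2 ≤ j ≤ n), Λₙ ≥ 1 — depending additionally on Λ₀ and Λ₁ — such that the following holds for any q ∈ ℕ and τ ∈ (0,1]. Let A : (ℝ^d)^n → ℝ^{d×d} be smooth, multiperiodic and λ-elliptic with ‖|D^ℓ A|‖_{L∞} ≤ C₀·Λ₀^ℓ·ℓ! for all ℓ ∈ ℕ, let F : (ℝ^d)^n → ℝ^d be smooth and multiperiodic with ‖|D^ℓ F|‖_{L²} ≤ Λ₁^ℓ·(ℓ+q)! for all ℓ ∈ ℕ, and let Y : (ℝ^d)^n → ℝ be smooth, multiperiodic and satisfy −∇̂·(A ∇̂Y) + τ²·Y = ∇̂·F pointwise. If ℓ ∈ ℕ is such that for every 2 ≤ j ≤ n there exists an integer kⱼ ≥ 1 with (δⱼ/δⱼ₋₁)·C̃ⱼ³·Λ̃ⱼ·(ℓ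 + kⱼ + q) ≤ e⁻¹ and τ² ≥ C̃ⱼ³·Λ̃ⱼ·δⱼ₋₁⁻¹·e^{−kⱼ+1}, then ‖|D^ℓ Y|‖_{L²} ≤ Cₙ·Λₙ^ℓ·(ℓ+1+q)!. -/

import Mathlib

open MeasureTheory Real

noncomputable section

namespace MS

/-- Points of `(ℝ^d)^n`. -/
abbrev Dom (d n : ℕ) := Fin n → Fin d → ℝ

/-- Partial derivative of `u` in the coordinate direction `y_i^k`. -/
def pd {d n : ℕ} (i : Fin n) (k : Fin d) (u : Dom d n → ℝ) (y : Dom d n) : ℝ :=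
  fderiv ℝ u y (Pi.single i (Pi.single k 1))

/-- Multiperiodicity: invariance under integer translations in each argument. -/
def MPeriodic {d n : ℕ} (u : Dom d n → ℝ) : Prop :=
  ∀ (y : Dom d n) (z : Fin n → Fin d → ℤ), u (fun i k => y i k + (z i k : ℝ)) = u y

/-- The unit periodicity cell `[0,1]^{d × n}`. -/
def cell (d n : ℕ) : Set (Dom d n) := Set.Icc 0 1

/-- Pointwise `|D^ℓ u|`: the sum, over all ℓ-tuples of coordinate directions, of the
absolute values of the corresponding ℓ-th order partial derivatives of the scalar `u`. -/
def DAbs {d n : ℕ} (ℓ : ℕ) (u : Dom d n → ℝ) (y : Dom d n) : ℝ :=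
  ∑ idx : Fin ℓ → Fin n × Fin d,
    |iteratedFDeriv ℝ ℓ u y fun m => Pi.single (idx m).1 (Pi.single (idx m).2 1)|

/-- L² norm over the unit cell. -/
def L2 {d n : ℕ} (F : Dom d n → ℝ) : ℝ :=
  Real.sqrt (∫ y in cell d n, (F y) ^ 2)

/-- k-th component of the truncated directional gradient `Σ_{i<m} δ_i⁻¹ ∂/∂y_i^k`;
with `m = n` this is the k-th component of `∇̂`. -/
def gradHatC {d n : ℕ} (δ : Fin n → ℝ) (m : ℕ) (k : Fin d) (u : Dom d n → ℝ) (y : Dom d n) : ℝ :=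
  ∑ i : Fin n, if (i : ℕ) < m then (δ i)⁻¹ * pd i k u y else 0

/-- λ-ellipticity of a matrix-valued map: `ξ·Aξ ≥ λ|ξ|²` and `|Aξ| ≤ λ⁻¹|ξ|`. -/
def Elliptic {d n : ℕ} (lam : ℝ) (A : Dom d n → Fin d → Fin d → ℝ) : Prop :=
  ∀ (y : Dom d n) (ξ : Fin d → ℝ),
    (lam * ∑ k, ξ k ^ 2 ≤ ∑ k, ξ k * ∑ l, A y k l * ξ l) ∧
    Real.sqrt (∑ k, (∑ l, A y k l * ξ l) ^ 2) ≤ lam⁻¹ * Real.sqrt (∑ k, ξ k ^ 2)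

/-- The half-open unit box with lower corner `c`. -/
def box {d n : ℕ} (c : Dom d n) : Set (Dom d n) :=
  Set.univ.pi fun i => Set.univ.pi fun k => Set.Ico (c i k) (c i k + 1)

theorem cell_ae_eq_box (d n : ℕ) : cell d n =ᵐ[volume] box (0 : Dom d n) := by
  have h : cell d n = Set.univ.pi fun _ => Set.Icc (0 : Fin d → ℝ) 1 := by
    rw [Set.pi_univ_Icc]; rfl
  rw [h]
  refine Measure.ae_eq_set_pi fun i _ => ?_
  have := (Measure.univ_pi_Ico_ae_eq_Icc (μ := fun _ : Fin d => (volume : Measure ℝ))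
    (f := 0) (g := 1)).symm
  simpa [volume_pi] using this

/-- The additive group of integer vectors in `(ℝ^d)^n`. -/
def intLattice (d n : ℕ) : AddSubgroup (Dom d n) where
  carrier := {y | ∃ z : Fin n → Fin d → ℤ, y = fun i k => (z i k : ℝ)}
  zero_mem' := ⟨0, by ext; simp⟩
  add_mem' := by
    rintro _ _ ⟨z, rfl⟩ ⟨w, rfl⟩
    exact ⟨z + w, by ext; simp⟩
  neg_mem' := by
    rintro _ ⟨z, rfl⟩
    exact ⟨-z, by ext; simp⟩

instance (d n : ℕ) : Countable (intLattice d n) := by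
  have : Function.Surjective (fun z : Fin n → Fin d → ℤ =>
      (⟨fun i k => (z i k : ℝ), z, rfl⟩ : intLattice d n)) := by
    rintro ⟨_, z, rfl⟩
    exact ⟨z, rfl⟩
  exact this.countable

theorem isAddFundamentalDomain_box {d n : ℕ} (c : Dom d n) :
    IsAddFundamentalDomain (intLattice d n) (box c) volume := by
  refine IsAddFundamentalDomain.mk' ?_ fun x => ?_
  · exact (MeasurableSet.univ_pi fun i => MeasurableSet.univ_pi fun k =>
      measurableSet_Ico).nullMeasurableSet
  · have key : ∀ i k, ∃! m : ℤ, x i k + m • (1 : ℝ) ∈ Set.Ico (c i k) (c i k + 1) :=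
      fun i k => existsUnique_add_zsmul_mem_Ico one_pos (x i k) (c i k)
    choose z hz hz' using key
    refine ⟨⟨fun i k => (z i k : ℝ), z, rfl⟩, ?_, ?_⟩
    · intro i _ k _
      have := hz i k
      simpa [AddSubgroup.vadd_def, add_comm] using this
    · rintro ⟨_, w, rfl⟩ hw
      ext i k
      have h1 := hw i trivial k trivial
      have := hz' i k (w i k) (by simpa [AddSubgroup.vadd_def, add_comm] using h1)
      simp [this]

theorem MPeriodic.setIntegral_cell_add {d n : ℕ} {f : Dom d n → ℝ} (hf : MPeriodic f)
    (v : Dom d n) : ∫ y in cell d n, f (y + v) = ∫ y in cell d n, f y := by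
  rw [setIntegral_congr_set (cell_ae_eq_box d n), setIntegral_congr_set (cell_ae_eq_box d n)]
  have hpre : box (0 : Dom d n) = (fun y => y + v) ⁻¹' box v := by
    ext y
    simp [box, Set.mem_pi, add_comm]
  rw [hpre, (measurePreserving_add_right volume v).setIntegral_preimage_emb
    (measurableEmbedding_addRight v), ← hpre]
  refine (isAddFundamentalDomain_box v).setIntegral_eq (isAddFundamentalDomain_box 0) ?_
  rintro ⟨_, z, rfl⟩ x
  have := hf x z
  rw [← this]
  congr 1
  ext i k
  simp [AddSubgroup.vadd_def, add_comm]

theorem isCompact_cell (d n : ℕ) : IsCompact (cell d n) := isCompact_Icc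

theorem volume_real_cell (d n : ℕ) : volume.real (cell d n) = 1 := by
  have h : cell d n = Set.univ.pi fun _ => Set.univ.pi fun _ => Set.Icc (0 : ℝ) 1 := by
    ext y
    simp [cell, Pi.le_def]
  simp only [h, measureReal_def, volume_pi_pi]
  simp

theorem integrableOn_cell {d n : ℕ} {f : Dom d n → ℝ} (hf : Continuous f) :
    IntegrableOn f (cell d n) :=
  hf.continuousOn.integrableOn_compact (isCompact_cell d n)

/-- Fubini's theorem for a continuous function on a product of compact sets. -/
theorem setIntegral_setIntegral_swap {X Y : Type*} [TopologicalSpace X] [TopologicalSpace Y]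
    [SecondCountableTopology X] [SecondCountableTopology Y]
    [T2Space X] [T2Space Y] [MeasureSpace X] [MeasureSpace Y] [BorelSpace X] [BorelSpace Y]
    [SFinite (volume : Measure X)] [SFinite (volume : Measure Y)]
    [IsFiniteMeasureOnCompacts (volume : Measure X)]
    [IsFiniteMeasureOnCompacts (volume : Measure Y)]
    {s : Set X} {t : Set Y} (hs : IsCompact s) (ht : IsCompact t) {f : X → Y → ℝ}
    (hf : Continuous (Function.uncurry f)) :
    ∫ x in s, ∫ y in t, f x y = ∫ y in t, ∫ x in s, f x y := by
  refine integral_integral_swap ?_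
  rw [Measure.prod_restrict]
  exact hf.continuousOn.integrableOn_compact (hs.prod ht)

/-- Smooth multiperiodic functions. -/
structure SmoothPer {d n : ℕ} (u : Dom d n → ℝ) : Prop where
  smooth : ContDiff ℝ (⊤ : ℕ∞) u
  periodic : MPeriodic u

namespace SmoothPer

variable {d n : ℕ} {u w : Dom d n → ℝ}

theorem continuous (hu : SmoothPer u) : Continuous u := hu.smooth.continuous

theorem differentiable (hu : SmoothPer u) : Differentiable ℝ u :=
  hu.smooth.differentiable (by simp)

theorem const (c : ℝ) : SmoothPer (fun _ : Dom d n => c) := ⟨contDiff_const, fun _ _ => rfl⟩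

theorem add (hu : SmoothPer u) (hw : SmoothPer w) : SmoothPer fun y => u y + w y :=
  ⟨hu.smooth.add hw.smooth, fun y z => by simp only [hu.periodic y z, hw.periodic y z]⟩

theorem sub (hu : SmoothPer u) (hw : SmoothPer w) : SmoothPer fun y => u y - w y :=
  ⟨hu.smooth.sub hw.smooth, fun y z => by simp only [hu.periodic y z, hw.periodic y z]⟩

theorem mul (hu : SmoothPer u) (hw : SmoothPer w) : SmoothPer fun y => u y * w y :=
  ⟨hu.smooth.mul hw.smooth, fun y z => by simp only [hu.periodic y z, hw.periodic y z]⟩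

theorem const_mul (c : ℝ) (hu : SmoothPer u) : SmoothPer fun y => c * u y :=
  (const c).mul hu

theorem sum {ι : Type*} {s : Finset ι} {f : ι → Dom d n → ℝ} (hf : ∀ i ∈ s, SmoothPer (f i)) :
    SmoothPer fun y => ∑ i ∈ s, f i y :=
  ⟨ContDiff.sum fun i hi => (hf i hi).smooth,
    fun y z => Finset.sum_congr rfl fun i hi => (hf i hi).periodic y z⟩

theorem fderiv_apply (hu : SmoothPer u) (v : Dom d n) : SmoothPer fun y => fderiv ℝ u y v := by
  refine ⟨(hu.smooth.fderiv_right (m := (⊤ : ℕ∞)) (by simp)).clm_apply contDiff_const,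
    fun y z => ?_⟩
  have h : (fun x => u (x + fun i k => (z i k : ℝ))) = u := funext fun x => hu.periodic x z
  have := fderiv_comp_add_right (𝕜 := ℝ) (f := u) (x := y) (fun i k => (z i k : ℝ))
  rw [h] at this
  rw [this]
  rfl

theorem pd (hu : SmoothPer u) (i : Fin n) (k : Fin d) : SmoothPer (pd i k u) :=
  hu.fderiv_apply _

theorem gradHatC (hu : SmoothPer u) (δ : Fin n → ℝ) (m : ℕ) (k : Fin d) :
    SmoothPer (gradHatC δ m k u) := by
  refine sum fun i _ => ?_
  by_cases h : (i : ℕ) < m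
  · simpa only [h, if_true] using (hu.pd i k).const_mul (δ i)⁻¹
  · simpa only [h, if_false] using const 0

end SmoothPer

section L2

variable {d n : ℕ} {f g : Dom d n → ℝ}

theorem L2_nonneg (f : Dom d n → ℝ) : 0 ≤ L2 f := Real.sqrt_nonneg _

theorem L2_sq (f : Dom d n → ℝ) : L2 f ^ 2 = ∫ y in cell d n, f y ^ 2 :=
  Real.sq_sqrt (integral_nonneg fun _ => sq_nonneg _)

theorem abs_setIntegral_mul_le (hf : Continuous f) (hg : Continuous g) :
    |∫ y in cell d n, f y * g y| ≤ L2 f * L2 g := by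
  refine abs_le_of_sq_le_sq ?_ (mul_nonneg (L2_nonneg f) (L2_nonneg g))
  have key : ∀ t : ℝ, 0 ≤ L2 f ^ 2 * (t * t) + (-2 * ∫ y in cell d n, f y * g y) * t
      + L2 g ^ 2 := by
    intro t
    have h : ∫ y in cell d n, (t * f y - g y) ^ 2 =
        L2 f ^ 2 * (t * t) + (-2 * ∫ y in cell d n, f y * g y) * t + L2 g ^ 2 := by
      rw [L2_sq, L2_sq]
      have : ∀ y, (t * f y - g y) ^ 2 = (t * t) * f y ^ 2 + (-2 * t) * (f y * g y) + g y ^ 2 :=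
        fun y => by ring
      simp only [this]
      rw [integral_add, integral_add, integral_const_mul, integral_const_mul]
      · ring
      all_goals exact integrableOn_cell (by fun_prop)
    rw [← h]
    exact integral_nonneg fun _ => sq_nonneg _
  have := discrim_le_zero key
  unfold discrim at this
  nlinarith

theorem L2_le_of_sq_le {r : ℝ} (hr : 0 ≤ r) (h : ∫ y in cell d n, f y ^ 2 ≤ r ^ 2) : L2 f ≤ r :=
  Real.sqrt_le_iff.2 ⟨hr, h⟩

theorem L2_add_le (hf : Continuous f) (hg : Continuous g) :
    L2 (fun y => f y + g y) ≤ L2 f + L2 g := by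
  refine L2_le_of_sq_le (add_nonneg (L2_nonneg f) (L2_nonneg g)) ?_
  have h : ∫ y in cell d n, (f y + g y) ^ 2 =
      L2 f ^ 2 + 2 * (∫ y in cell d n, f y * g y) + L2 g ^ 2 := by
    rw [L2_sq, L2_sq]
    have : ∀ y, (f y + g y) ^ 2 = f y ^ 2 + 2 * (f y * g y) + g y ^ 2 := fun y => by ring
    simp only [this]
    rw [integral_add, integral_add, integral_const_mul]
    all_goals exact integrableOn_cell (by fun_prop)
  have := (le_abs_self _).trans (abs_setIntegral_mul_le hf hg)
  rw [h]
  nlinarith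

theorem L2_zero : L2 (fun _ : Dom d n => (0 : ℝ)) = 0 := by simp [L2]

theorem L2_sum_le {ι : Type*} (s : Finset ι) {F : ι → Dom d n → ℝ}
    (hF : ∀ i ∈ s, Continuous (F i)) :
    L2 (fun y => ∑ i ∈ s, F i y) ≤ ∑ i ∈ s, L2 (F i) := by
  classical
  induction s using Finset.induction_on with
  | empty => simp [L2_zero]
  | insert a s ha ih =>
    simp only [Finset.sum_insert ha]
    have hs : ∀ i ∈ s, Continuous (F i) := fun i hi => hF i (Finset.mem_insert_of_mem hi)
    exact (L2_add_le (hF a (Finset.mem_insert_self a s))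
      (continuous_finsetSum s hs)).trans (by gcongr; exact ih hs)

theorem L2_le_mul_of_abs_le {M : ℝ} (hM : 0 ≤ M) (hf : Continuous f) (hg : Continuous g)
    (h : ∀ y, |f y| ≤ M * |g y|) : L2 f ≤ M * L2 g := by
  refine L2_le_of_sq_le (mul_nonneg hM (L2_nonneg g)) ?_
  rw [mul_pow, L2_sq, ← integral_const_mul]
  refine integral_mono (integrableOn_cell (by fun_prop)) (integrableOn_cell (by fun_prop))
    fun y => ?_
  have := pow_le_pow_left₀ (abs_nonneg _) (h y) 2
  simpa [mul_pow] using this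

theorem L2_mono (hf : Continuous f) (hg : Continuous g) (h : ∀ y, |f y| ≤ |g y|) :
    L2 f ≤ L2 g := by
  simpa using L2_le_mul_of_abs_le zero_le_one hf hg (by simpa using h)

theorem L2_const_mul_le (c : ℝ) (hf : Continuous f) : L2 (fun y => c * f y) ≤ |c| * L2 f :=
  L2_le_mul_of_abs_le (abs_nonneg c) (by fun_prop) hf fun y => (abs_mul c (f y)).le

theorem L2_abs (f : Dom d n → ℝ) : L2 (fun y => |f y|) = L2 f := by simp [L2]

theorem MPeriodic.L2_comp_add (hf : MPeriodic f) (v : Dom d n) : L2 (fun y => f (y + v)) = L2 f := by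
  have h : MPeriodic fun y => f y ^ 2 := fun y z => by simp only [hf y z]
  unfold L2
  rw [h.setIntegral_cell_add v]

end L2

section Translation

variable {d n : ℕ} {u w : Dom d n → ℝ}

theorem sub_eq_setIntegral_fderiv (hu : SmoothPer u) (y v : Dom d n) :
    u (y + v) - u y = ∫ s in Set.Icc (0 : ℝ) 1, fderiv ℝ u (y + s • v) v := by
  have hd : ∀ s : ℝ, HasDerivAt (fun s : ℝ => u (y + s • v)) (fderiv ℝ u (y + s • v) v) s := by
    intro s
    have h1 : HasDerivAt (fun s : ℝ => y + s • v) v s := by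
      simpa using ((hasDerivAt_id s).smul_const v).const_add y
    exact (hu.differentiable _).hasFDerivAt.comp_hasDerivAt s h1
  have hc : Continuous fun s : ℝ => fderiv ℝ u (y + s • v) v :=
    (hu.fderiv_apply v).continuous.comp (by fun_prop)
  have := intervalIntegral.integral_eq_sub_of_hasDerivAt (a := 0) (b := 1) (fun s _ => hd s)
    (hc.intervalIntegrable _ _)
  rw [integral_Icc_eq_integral_Ioc, ← intervalIntegral.integral_of_le zero_le_one, this]
  simp

theorem sq_setIntegral_Icc_le {g : ℝ → ℝ} (hg : Continuous g) :
    (∫ s in Set.Icc (0 : ℝ) 1, g s) ^ 2 ≤ ∫ s in Set.Icc (0 : ℝ) 1, g s ^ 2 := by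
  set m := ∫ s in Set.Icc (0 : ℝ) 1, g s with hm
  have hi : ∀ h : ℝ → ℝ, Continuous h → IntegrableOn h (Set.Icc (0 : ℝ) 1) :=
    fun h hh => hh.continuousOn.integrableOn_compact isCompact_Icc
  have h : ∫ s in Set.Icc (0 : ℝ) 1, (g s - m) ^ 2 =
      (∫ s in Set.Icc (0 : ℝ) 1, g s ^ 2) - m ^ 2 := by
    have : ∀ s, (g s - m) ^ 2 = g s ^ 2 + (-2 * m) * g s + m ^ 2 := fun s => by ring
    simp only [this]
    rw [integral_add, integral_add, integral_const_mul, ← hm]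
    · simp
      ring
    all_goals exact hi _ (by fun_prop)
  have h0 : 0 ≤ ∫ s in Set.Icc (0 : ℝ) 1, (g s - m) ^ 2 := integral_nonneg fun _ => sq_nonneg _
  linarith

theorem setIntegral_fderiv_eq_zero (hu : SmoothPer u) (v : Dom d n) :
    ∫ y in cell d n, fderiv ℝ u y v = 0 := by
  have hv := hu.fderiv_apply v
  have h1 : ∫ y in cell d n, (u (y + v) - u y) = 0 := by
    rw [integral_sub, hu.periodic.setIntegral_cell_add, sub_self]
    all_goals exact integrableOn_cell (by have := hu.continuous; fun_prop)
  simp only [sub_eq_setIntegral_fderiv hu] at h1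
  have hc : Continuous (Function.uncurry fun (y : Dom d n) (s : ℝ) => fderiv ℝ u (y + s • v) v) :=
    hv.continuous.comp (f := fun p : Dom d n × ℝ => p.1 + p.2 • v) (by fun_prop)
  rw [setIntegral_setIntegral_swap (isCompact_cell d n) isCompact_Icc hc] at h1
  simpa [hv.periodic.setIntegral_cell_add] using h1

theorem L2_translate_sub_le (hu : SmoothPer u) (v : Dom d n) :
    L2 (fun y => u (y + v) - u y) ≤ L2 fun y => fderiv ℝ u y v := by
  have hv := hu.fderiv_apply v
  have huc := hu.continuous
  have hp : MPeriodic fun y => fderiv ℝ u y v ^ 2 := fun y z => by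
    have := hv.periodic y z
    simp only [this]
  refine L2_le_of_sq_le (L2_nonneg _) ?_
  have hc : Continuous (Function.uncurry fun (y : Dom d n) (s : ℝ) =>
      fderiv ℝ u (y + s • v) v ^ 2) :=
    (hv.continuous.comp (f := fun p : Dom d n × ℝ => p.1 + p.2 • v) (by fun_prop)).pow 2
  calc ∫ y in cell d n, (u (y + v) - u y) ^ 2
      ≤ ∫ y in cell d n, ∫ s in Set.Icc (0 : ℝ) 1, fderiv ℝ u (y + s • v) v ^ 2 := by
        refine integral_mono (integrableOn_cell (by fun_prop)) (integrableOn_cell ?_) fun y => ?_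
        · exact continuous_parametric_integral_of_continuous hc isCompact_Icc
        · simp only [sub_eq_setIntegral_fderiv hu]
          exact sq_setIntegral_Icc_le (hv.continuous.comp (by fun_prop))
    _ = ∫ s in Set.Icc (0 : ℝ) 1, ∫ y in cell d n, fderiv ℝ u (y + s • v) v ^ 2 :=
        setIntegral_setIntegral_swap (isCompact_cell d n) isCompact_Icc hc
    _ = L2 (fun y => fderiv ℝ u y v) ^ 2 := by
        rw [L2_sq]
        have : ∀ s : ℝ, ∫ y in cell d n, fderiv ℝ u (y + s • v) v ^ 2 =
            ∫ y in cell d n, fderiv ℝ u y v ^ 2 := fun s => hp.setIntegral_cell_add (s • v)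
        simp [this]

/-- A mean-zero periodic function is controlled by its oscillation under translations. -/
theorem L2_le_of_translate (hu : SmoothPer u) (h0 : ∫ y in cell d n, u y = 0) {R : ℝ}
    (hR : ∀ z : Dom d n, L2 (fun y => u (y + z) - u y) ≤ R) : L2 u ≤ R := by
  have huc := hu.continuous
  have hR0 : 0 ≤ R := (L2_nonneg _).trans (hR 0)
  have key : ∀ z : Dom d n, 2 * L2 u ^ 2 - R ^ 2 ≤ 2 * ∫ y in cell d n, u (y + z) * u y := by
    intro z
    have h1 := pow_le_pow_left₀ (L2_nonneg _) (hR z) 2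
    have h2 : L2 (fun y => u (y + z) - u y) ^ 2 =
        2 * L2 u ^ 2 - 2 * ∫ y in cell d n, u (y + z) * u y := by
      have h3 := congrArg (· ^ 2) (hu.periodic.L2_comp_add z)
      simp only [L2_sq] at h3 ⊢
      have : ∀ y, (u (y + z) - u y) ^ 2 = u (y + z) ^ 2 + (-2) * (u (y + z) * u y) + u y ^ 2 :=
        fun y => by ring
      simp only [this]
      rw [integral_add, integral_add, integral_const_mul, h3]
      · ring
      all_goals exact integrableOn_cell (by fun_prop)
    linarith
  have hc : Continuous (Function.uncurry fun (z y : Dom d n) => u (y + z) * u y) := by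
    simp only [Function.uncurry_def]
    fun_prop
  have hz : ∫ z in cell d n, ∫ y in cell d n, u (y + z) * u y = 0 := by
    rw [setIntegral_setIntegral_swap (isCompact_cell d n) (isCompact_cell d n) hc]
    simp only [integral_mul_const]
    have : ∀ y : Dom d n, ∫ z in cell d n, u (y + z) = 0 := fun y => by
      simp only [add_comm y]
      rw [hu.periodic.setIntegral_cell_add, h0]
    simp [this]
  have hm : ∫ _z in cell d n, (2 * L2 u ^ 2 - R ^ 2) ≤
      ∫ z in cell d n, 2 * ∫ y in cell d n, u (y + z) * u y := by
    refine integral_mono (integrableOn_cell (by fun_prop)) (integrableOn_cell ?_) fun z => key z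
    exact (continuous_parametric_integral_of_continuous hc (isCompact_cell d n)).const_mul 2
  rw [integral_const_mul, hz, setIntegral_const, volume_real_cell] at hm
  refine le_of_sq_le_sq ?_ hR0
  simp at hm
  nlinarith [sq_nonneg R]

end Translation

section Directional

variable {d n : ℕ} {u w : Dom d n → ℝ}

theorem gradHatC_self (δ : Fin n → ℝ) (k : Fin d) (u : Dom d n → ℝ) :
    gradHatC δ n k u = fun y => ∑ i, (δ i)⁻¹ * pd i k u y := by
  funext y
  simp [gradHatC]

theorem fderiv_apply_eq_sum (u : Dom d n → ℝ) (y v : Dom d n) :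
    fderiv ℝ u y v = ∑ i, ∑ k, v i k * pd i k u y := by
  have hv : v = ∑ i, ∑ k, v i k • (Pi.single i (Pi.single k (1 : ℝ)) : Dom d n) := by
    ext i k
    simp [Finset.sum_apply, Pi.single_apply, apply_ite, ite_apply]
  conv_lhs => rw [hv]
  simp [pd]

theorem L2_fderiv_apply_le (hu : SmoothPer u) (v : Dom d n) :
    L2 (fun y => fderiv ℝ u y v) ≤ ∑ i, ∑ k, |v i k| * L2 (pd i k u) := by
  have hc : ∀ i k, Continuous (pd i k u) := fun i k => (hu.pd i k).continuous
  simp only [fderiv_apply_eq_sum]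
  refine (L2_sum_le _ fun i _ => by fun_prop).trans (Finset.sum_le_sum fun i _ => ?_)
  refine (L2_sum_le _ fun k _ => by fun_prop).trans (Finset.sum_le_sum fun k _ => ?_)
  exact L2_const_mul_le _ (hc i k)

theorem L2_fderiv_apply_hat_le (hu : SmoothPer u) (δ : Fin n → ℝ) (T : Fin d → ℝ) :
    L2 (fun y => fderiv ℝ u y fun i k => T k / δ i) ≤
      ∑ k, |T k| * L2 (gradHatC δ n k u) := by
  have hc : ∀ k, Continuous (gradHatC δ n k u) := fun k => (hu.gradHatC δ n k).continuous
  have h : ∀ y, fderiv ℝ u y (fun i k => T k / δ i) = ∑ k, T k * gradHatC δ n k u y := by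
    intro y
    rw [fderiv_apply_eq_sum, Finset.sum_comm]
    refine Finset.sum_congr rfl fun k _ => ?_
    rw [gradHatC_self, Finset.mul_sum]
    exact Finset.sum_congr rfl fun i _ => by ring
  simp only [h]
  refine (L2_sum_le _ fun k _ => by fun_prop).trans (Finset.sum_le_sum fun k _ => ?_)
  exact L2_const_mul_le _ (hc k)

/-- Well-separated scales: a single shift `T` realizes, up to integers and a small error, any
prescribed vector of shifts at all scales simultaneously. -/
theorem exists_shift {δ : Fin n → ℝ} {ε : ℝ} (hpos : ∀ i, 0 < δ i) (hle : ∀ i, δ i ≤ 1)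
    (hε0 : 0 ≤ ε) (hε : ∀ i j, i < j → δ j ≤ ε * δ i) (z : Fin n → ℝ) :
    ∃ (T : ℝ) (m : Fin n → ℤ), |T| ≤ n ∧ ∀ i, |z i - T / δ i - m i| ≤ n * ε := by
  have key : ∀ j : ℕ, j ≤ n → ∃ (T : ℝ) (m : Fin n → ℤ), |T| ≤ j ∧
      ∀ i : Fin n, (i : ℕ) < j → |z i - T / δ i - m i| ≤ j * ε := by
    intro j
    induction j with
    | zero => exact fun _ => ⟨0, 0, by simp, fun i hi => absurd hi (by omega)⟩
    | succ j ih =>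
      intro hj
      obtain ⟨T, m, hT, hm⟩ := ih (by omega)
      let a : Fin n := ⟨j, by omega⟩
      set x := z a - T / δ a
      have hx0 := Int.fract_nonneg x
      have hx1 := (Int.fract_lt_one x).le
      refine ⟨T + δ a * Int.fract x, Function.update m a ⌊x⌋, ?_, fun i hi => ?_⟩
      · have h1 : |δ a * Int.fract x| ≤ 1 := by
          rw [abs_of_nonneg (mul_nonneg (hpos a).le hx0)]
          exact mul_le_one₀ (hle a) hx0 hx1
        push_cast
        exact (abs_add_le _ _).trans (by linarith)
      · by_cases hia : i = a
        · rw [hia]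
          have : z a - (T + δ a * Int.fract x) / δ a - (Function.update m a ⌊x⌋ a : ℤ) = 0 := by
            have := (hpos a).ne'
            rw [Function.update_self, Int.fract]
            field_simp
            simp only [x]
            field_simp
            ring
          rw [this, abs_zero]
          positivity
        · have hij : (i : ℕ) < j := by
            have : (i : ℕ) ≠ j := fun h => hia (Fin.ext h)
            omega
          have h1 := hm i hij
          have h2 : |δ a * Int.fract x / δ i| ≤ ε := by
            rw [abs_of_nonneg (div_nonneg (mul_nonneg (hpos a).le hx0) (hpos i).le),
              div_le_iff₀ (hpos i)]
            exact (mul_le_of_le_one_right (hpos a).le hx1).trans (hε i a hij)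
          rw [Function.update_of_ne hia]
          have h3 : z i - (T + δ a * Int.fract x) / δ i - (m i : ℝ) =
              (z i - T / δ i - m i) - δ a * Int.fract x / δ i := by ring
          rw [h3]
          push_cast
          exact (abs_sub _ _).trans (by linarith)
  obtain ⟨T, m, hT, hm⟩ := key n le_rfl
  exact ⟨T, m, hT, fun i => hm i i.2⟩

/-- Poincaré inequality for the directional gradient with well-separated scales. -/
theorem L2_le_gradHat {δ : Fin n → ℝ} {ε : ℝ} (hpos : ∀ i, 0 < δ i) (hle : ∀ i, δ i ≤ 1)
    (hε0 : 0 ≤ ε) (hε : ∀ i j, i < j → δ j ≤ ε * δ i) (hu : SmoothPer u)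
    (h0 : ∫ y in cell d n, u y = 0) :
    L2 u ≤ n * ∑ k, L2 (gradHatC δ n k u) + n * ε * ∑ i, ∑ k, L2 (pd i k u) := by
  have huc := hu.continuous
  refine L2_le_of_translate hu h0 fun z => ?_
  choose T m hT hm using fun k : Fin d => exists_shift hpos hle hε0 hε (fun i => z i k)
  set v : Dom d n := fun i k => T k / δ i with hv
  set r : Dom d n := fun i k => z i k - T k / δ i - m k i with hr
  have hz : ∀ y, u (y + z) = u (y + v + r) := by
    intro y
    rw [← hu.periodic (y + v + r) fun i k => m k i]
    congr 1
    ext i k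
    simp only [hv, hr, Pi.add_apply]
    ring
  have hper : MPeriodic fun y => u (y + r) - u y := fun y z => by
    have h1 := hu.periodic (y + r) z
    have h2 : (fun i k => y i k + (z i k : ℝ)) + r = fun i k => (y + r) i k + (z i k : ℝ) := by
      ext i k
      simp only [Pi.add_apply]
      ring
    simp only [h2, h1, hu.periodic y z]
  calc L2 (fun y => u (y + z) - u y)
      = L2 fun y => (u (y + v) - u y) + (u (y + v + r) - u (y + v)) := by
        congr 1
        funext y
        rw [hz]
        ring
    _ ≤ L2 (fun y => u (y + v) - u y) + L2 (fun y => u (y + v + r) - u (y + v)) :=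
        L2_add_le (by fun_prop) (by fun_prop)
    _ ≤ n * ∑ k, L2 (gradHatC δ n k u) + n * ε * ∑ i, ∑ k, L2 (pd i k u) := by
        refine add_le_add ?_ ?_
        · refine (L2_translate_sub_le hu v).trans ((L2_fderiv_apply_hat_le hu δ T).trans ?_)
          rw [Finset.mul_sum]
          exact Finset.sum_le_sum fun k _ => mul_le_mul_of_nonneg_right (hT k) (L2_nonneg _)
        · rw [hper.L2_comp_add v]
          refine (L2_translate_sub_le hu r).trans ((L2_fderiv_apply_le hu r).trans ?_)
          simp only [Finset.mul_sum]
          exact Finset.sum_le_sum fun i _ => Finset.sum_le_sum fun k _ =>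
            mul_le_mul_of_nonneg_right (hm k i) (L2_nonneg _)

end Directional

section Energy

variable {d n : ℕ} {u w : Dom d n → ℝ}

theorem pd_add (i : Fin n) (k : Fin d) (hu : SmoothPer u) (hw : SmoothPer w) :
    pd i k (fun y => u y + w y) = fun y => pd i k u y + pd i k w y := by
  funext y
  simp only [pd]
  rw [fderiv_fun_add (hu.differentiable y) (hw.differentiable y)]
  rfl

theorem pd_mul (i : Fin n) (k : Fin d) (hu : SmoothPer u) (hw : SmoothPer w) :
    pd i k (fun y => u y * w y) = fun y => pd i k u y * w y + u y * pd i k w y := by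
  funext y
  simp only [pd]
  rw [fderiv_fun_mul (hu.differentiable y) (hw.differentiable y)]
  simp
  ring

theorem pd_const_mul (i : Fin n) (k : Fin d) (c : ℝ) (hu : SmoothPer u) :
    pd i k (fun y => c * u y) = fun y => c * pd i k u y := by
  rw [pd_mul i k (.const c) hu]
  simp [pd]

theorem pd_comm (i j : Fin n) (k l : Fin d) (hu : SmoothPer u) :
    pd i k (pd j l u) = pd j l (pd i k u) := by
  funext y
  have hdd : DifferentiableAt ℝ (fderiv ℝ u) y :=
    (hu.smooth.fderiv_right (m := (⊤ : ℕ∞)) (by simp)).differentiable (by simp) y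
  have hs : IsSymmSndFDerivAt ℝ u y :=
    (hu.smooth.contDiffAt).isSymmSndFDerivAt (by
      simp only [minSmoothness_of_isRCLikeNormedField]
      exact WithTop.coe_le_coe.2 le_top)
  have h : ∀ (i j : Fin n) (k l : Fin d), pd i k (pd j l u) y =
      fderiv ℝ (fderiv ℝ u) y (Pi.single i (Pi.single k 1)) (Pi.single j (Pi.single l 1)) := by
    intro i j k l
    have : pd j l u = fun y => fderiv ℝ u y (Pi.single j (Pi.single l 1)) := rfl
    rw [this, pd, fderiv_clm_apply hdd (differentiableAt_const _)]
    simp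
  rw [h, h]
  exact hs _ _

theorem gradHatC_mul (δ : Fin n → ℝ) (k : Fin d) (hu : SmoothPer u) (hw : SmoothPer w)
    (y : Dom d n) : gradHatC δ n k (fun y => u y * w y) y =
      gradHatC δ n k u y * w y + u y * gradHatC δ n k w y := by
  simp only [gradHatC_self, pd_mul _ _ hu hw, Finset.sum_mul, Finset.mul_sum]
  rw [← Finset.sum_add_distrib]
  exact Finset.sum_congr rfl fun i _ => by ring

theorem gradHatC_add (δ : Fin n → ℝ) (k : Fin d) (hu : SmoothPer u) (hw : SmoothPer w) :
    gradHatC δ n k (fun y => u y + w y) = fun y => gradHatC δ n k u y + gradHatC δ n k w y := by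
  simp only [gradHatC_self, pd_add _ _ hu hw, mul_add, Finset.sum_add_distrib]

theorem setIntegral_gradHatC (δ : Fin n → ℝ) (k : Fin d) (hu : SmoothPer u) :
    ∫ y in cell d n, gradHatC δ n k u y = 0 := by
  simp only [gradHatC_self]
  rw [integral_finsetSum _ fun i _ =>
    integrableOn_cell (((hu.pd i k).const_mul _).continuous)]
  refine Finset.sum_eq_zero fun i _ => ?_
  rw [integral_const_mul]
  exact mul_eq_zero_of_right _ (setIntegral_fderiv_eq_zero hu _)

theorem setIntegral_gradHatC_mul (δ : Fin n → ℝ) (k : Fin d) (hu : SmoothPer u)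
    (hw : SmoothPer w) : ∫ y in cell d n, gradHatC δ n k u y * w y =
      -∫ y in cell d n, u y * gradHatC δ n k w y := by
  have h := setIntegral_gradHatC δ k (hu.mul hw)
  simp only [gradHatC_mul δ k hu hw] at h
  rw [integral_add (integrableOn_cell ((hu.gradHatC δ n k).mul hw).continuous)
    (integrableOn_cell (hu.mul (hw.gradHatC δ n k)).continuous)] at h
  linarith

/-- Energy estimate for the regularized corrector equation. -/
theorem energy_estimate {lam τ : ℝ} (hlam : lam ∈ Set.Ioc (0 : ℝ) 1) (δ : Fin n → ℝ)
    {A : Dom d n → Fin d → Fin d → ℝ} {G : Fin d → Dom d n → ℝ}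
    (hA : ∀ k l, SmoothPer fun y => A y k l) (hell : Elliptic lam A) (hu : SmoothPer u)
    (hG : ∀ k, SmoothPer (G k))
    (heq : ∀ y, -(∑ k, gradHatC δ n k (fun y' => ∑ l, A y' k l * gradHatC δ n l u y') y)
      + τ ^ 2 * u y = ∑ k, gradHatC δ n k (G k) y) :
    (∀ k, L2 (gradHatC δ n k u) ≤ lam⁻¹ * ∑ k, L2 (G k)) ∧
      τ * L2 u ≤ lam⁻¹ * ∑ k, L2 (G k) := by
  obtain ⟨hl0, hl1⟩ := hlam
  set P : Fin d → Dom d n → ℝ := fun k y => ∑ l, A y k l * gradHatC δ n l u y with hP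
  have hg : ∀ k, SmoothPer (gradHatC δ n k u) := fun k => hu.gradHatC δ n k
  have hPs : ∀ k, SmoothPer (P k) := fun k => SmoothPer.sum fun l _ => (hA k l).mul (hg l)
  have hsum : ∀ (Q : Fin d → Dom d n → ℝ), (∀ k, SmoothPer (Q k)) →
      ∫ y in cell d n, (∑ k, gradHatC δ n k (Q k) y) * u y =
        -∫ y in cell d n, ∑ k, Q k y * gradHatC δ n k u y := by
    intro Q hQ
    simp only [Finset.sum_mul]
    rw [integral_finsetSum _ fun k _ =>
        integrableOn_cell (((hQ k).gradHatC δ n k).mul hu).continuous,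
      integral_finsetSum _ fun k _ => integrableOn_cell ((hQ k).mul (hg k)).continuous,
      ← Finset.sum_neg_distrib]
    exact Finset.sum_congr rfl fun k _ => setIntegral_gradHatC_mul δ k (hQ k) hu
  have heq' : ∀ y, -(∑ k, gradHatC δ n k (P k) y) + τ ^ 2 * u y =
      ∑ k, gradHatC δ n k (G k) y := heq
  have htest : (∫ y in cell d n, ∑ k, P k y * gradHatC δ n k u y) + τ ^ 2 * L2 u ^ 2 =
      -∫ y in cell d n, ∑ k, G k y * gradHatC δ n k u y := by
    rw [← hsum G hG]
    simp only [← heq']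
    have h1 : ∀ y, (-(∑ k, gradHatC δ n k (P k) y) + τ ^ 2 * u y) * u y =
        -((∑ k, gradHatC δ n k (P k) y) * u y) + τ ^ 2 * u y ^ 2 := fun y => by ring
    have h2 : SmoothPer fun y => (∑ k, gradHatC δ n k (P k) y) * u y :=
      (SmoothPer.sum fun k _ => (hPs k).gradHatC δ n k).mul hu
    have huc := hu.continuous
    have h2c := h2.continuous
    simp only [h1]
    rw [integral_add (integrableOn_cell (by fun_prop)) (integrableOn_cell (by fun_prop)),
      integral_neg, hsum P hPs, integral_const_mul, L2_sq]
    ring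
  have hcoer : lam * ∑ k, L2 (gradHatC δ n k u) ^ 2 ≤
      ∫ y in cell d n, ∑ k, P k y * gradHatC δ n k u y := by
    simp only [L2_sq]
    have hgc := fun k => (hg k).continuous
    rw [← integral_finsetSum _ fun k _ => integrableOn_cell (by have := hgc k; fun_prop),
      ← integral_const_mul]
    refine integral_mono (integrableOn_cell (by fun_prop))
      (integrableOn_cell (SmoothPer.sum fun k _ => (hPs k).mul (hg k)).continuous) fun y => ?_
    have := (hell y fun k => gradHatC δ n k u y).1
    refine this.trans_eq (Finset.sum_congr rfl fun k _ => mul_comm _ _)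
  set s := Real.sqrt (∑ k, L2 (gradHatC δ n k u) ^ 2) with hs
  have hs0 : 0 ≤ s := Real.sqrt_nonneg _
  have hs2 : s ^ 2 = ∑ k, L2 (gradHatC δ n k u) ^ 2 :=
    Real.sq_sqrt (Finset.sum_nonneg fun k _ => sq_nonneg _)
  have hks : ∀ k, L2 (gradHatC δ n k u) ≤ s := fun k =>
    Real.le_sqrt_of_sq_le (Finset.single_le_sum (f := fun k => L2 (gradHatC δ n k u) ^ 2)
      (fun k _ => sq_nonneg _) (Finset.mem_univ k))
  set g := ∑ k, L2 (G k) with hgdef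
  have hg0 : 0 ≤ g := Finset.sum_nonneg fun k _ => L2_nonneg _
  have hrhs : -∫ y in cell d n, ∑ k, G k y * gradHatC δ n k u y ≤ g * s := by
    rw [integral_finsetSum _ fun k _ => integrableOn_cell ((hG k).mul (hg k)).continuous,
      ← Finset.sum_neg_distrib, hgdef, Finset.sum_mul]
    refine Finset.sum_le_sum fun k _ => (neg_le_abs _).trans
      ((abs_setIntegral_mul_le (hG k).continuous (hg k).continuous).trans ?_)
    exact mul_le_mul_of_nonneg_left (hks k) (L2_nonneg _)
  have hmain : lam * s ^ 2 + τ ^ 2 * L2 u ^ 2 ≤ g * s := by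
    rw [hs2]
    linarith
  have hsg : s ≤ lam⁻¹ * g := by
    rw [inv_mul_eq_div, le_div_iff₀ hl0]
    rcases hs0.eq_or_lt with h | h
    · rw [← h]
      simpa using hg0
    · have : 0 ≤ τ ^ 2 * L2 u ^ 2 := by positivity
      exact le_of_mul_le_mul_right (by nlinarith) h
  refine ⟨fun k => (hks k).trans hsg, le_of_sq_le_sq ?_ (by positivity)⟩
  have hl : 1 ≤ lam⁻¹ := (one_le_inv₀ hl0).2 hl1
  calc (τ * L2 u) ^ 2 ≤ g * s := by
        have : 0 ≤ lam * s ^ 2 := by positivity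
        nlinarith
    _ ≤ (lam⁻¹ * g) * (lam⁻¹ * g) :=
        mul_le_mul (le_mul_of_one_le_left hg0 hl) hsg hs0 (by positivity)
    _ = (lam⁻¹ * g) ^ 2 := by ring

end Energy

section IteratedDerivative

variable {d n : ℕ} {u w : Dom d n → ℝ}

/-- Iterated partial derivative along a list of coordinate directions. -/
def iterD {d n : ℕ} : List (Fin n × Fin d) → (Dom d n → ℝ) → Dom d n → ℝ
  | [], u => u
  | p :: L, u => iterD L (pd p.1 p.2 u)

theorem SmoothPer.iterD (hu : SmoothPer u) (L : List (Fin n × Fin d)) : SmoothPer (iterD L u) := by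
  induction L generalizing u with
  | nil => exact hu
  | cons p L ih => exact ih (hu.pd p.1 p.2)

theorem iterD_add (L : List (Fin n × Fin d)) (hu : SmoothPer u) (hw : SmoothPer w) :
    iterD L (fun y => u y + w y) = fun y => iterD L u y + iterD L w y := by
  induction L generalizing u w with
  | nil => rfl
  | cons p L ih => simp only [iterD, pd_add _ _ hu hw, ih (hu.pd _ _) (hw.pd _ _)]

theorem iterD_const_mul (L : List (Fin n × Fin d)) (c : ℝ) (hu : SmoothPer u) :
    iterD L (fun y => c * u y) = fun y => c * iterD L u y := by
  induction L generalizing u with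
  | nil => rfl
  | cons p L ih => simp only [iterD, pd_const_mul _ _ c hu, ih (hu.pd _ _)]

theorem iterD_zero (L : List (Fin n × Fin d)) :
    iterD L (fun _ => (0 : ℝ)) = fun _ => (0 : ℝ) := by
  simpa using iterD_const_mul L 0 (SmoothPer.const 0)

theorem iterD_sum (L : List (Fin n × Fin d)) {ι : Type*} (s : Finset ι) {f : ι → Dom d n → ℝ}
    (hf : ∀ i, SmoothPer (f i)) :
    iterD L (fun y => ∑ i ∈ s, f i y) = fun y => ∑ i ∈ s, iterD L (f i) y := by
  classical
  induction s using Finset.induction_on with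
  | empty => simpa using iterD_zero L
  | insert a s ha ih =>
    simp only [Finset.sum_insert ha]
    rw [iterD_add L (hf a) (SmoothPer.sum fun i _ => hf i), ih]

theorem iterD_pd (L : List (Fin n × Fin d)) (i : Fin n) (k : Fin d) (hu : SmoothPer u) :
    iterD L (pd i k u) = pd i k (iterD L u) := by
  induction L generalizing u with
  | nil => rfl
  | cons p L ih => rw [iterD, iterD, pd_comm _ _ _ _ hu, ih (hu.pd _ _)]

theorem iterD_gradHatC (L : List (Fin n × Fin d)) (δ : Fin n → ℝ) (k : Fin d)
    (hu : SmoothPer u) : iterD L (gradHatC δ n k u) = gradHatC δ n k (iterD L u) := by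
  rw [gradHatC_self, gradHatC_self, iterD_sum L _ fun i => (hu.pd i k).const_mul _]
  funext y
  exact Finset.sum_congr rfl fun i _ => by rw [iterD_const_mul L _ (hu.pd i k), iterD_pd L i k hu]

theorem iteratedFDeriv_apply_eq_iterD {ℓ : ℕ} (hu : SmoothPer u) (idx : Fin ℓ → Fin n × Fin d)
    (y : Dom d n) :
    (iteratedFDeriv ℝ ℓ u y fun m => Pi.single (idx m).1 (Pi.single (idx m).2 1)) =
      iterD (List.ofFn idx).reverse u y := by
  induction ℓ generalizing u with
  | zero => simp [iterD]
  | succ ℓ ih =>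
    have hL : (List.ofFn idx).reverse =
        idx (Fin.last ℓ) :: (List.ofFn fun m : Fin ℓ => idx m.castSucc).reverse := by
      rw [List.ofFn_succ']
      simp
    rw [hL, iterD, ← ih (hu.pd _ _) fun m => idx m.castSucc, iteratedFDeriv_succ_apply_right]
    have hc : ContDiff ℝ (⊤ : ℕ∞) (fun y => fderiv ℝ u y) :=
      hu.smooth.fderiv_right (m := (⊤ : ℕ∞)) (by simp)
    exact (iteratedFDeriv_clm_apply_const_apply hc (WithTop.coe_le_coe.2 le_top)).symm

theorem DAbs_eq_sum (hu : SmoothPer u) (ℓ : ℕ) :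
    DAbs ℓ u = fun y => ∑ idx : Fin ℓ → Fin n × Fin d, |iterD (List.ofFn idx).reverse u y| := by
  funext y
  simp only [DAbs, iteratedFDeriv_apply_eq_iterD hu]

theorem DAbs_nonneg (ℓ : ℕ) (u : Dom d n → ℝ) (y : Dom d n) : 0 ≤ DAbs ℓ u y :=
  Finset.sum_nonneg fun _ _ => abs_nonneg _

theorem continuous_DAbs (hu : SmoothPer u) (ℓ : ℕ) : Continuous (DAbs ℓ u) := by
  rw [DAbs_eq_sum hu]
  exact continuous_finsetSum _ fun idx _ => (hu.iterD _).continuous.abs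

theorem abs_iterD_le_DAbs (hu : SmoothPer u) (L : List (Fin n × Fin d)) (y : Dom d n) :
    |iterD L u y| ≤ DAbs L.length u y := by
  have h := Finset.single_le_sum
    (f := fun idx : Fin L.reverse.length → Fin n × Fin d => |iterD (List.ofFn idx).reverse u y|)
    (fun _ _ => abs_nonneg _) (Finset.mem_univ L.reverse.get)
  have h2 := congrFun (DAbs_eq_sum hu L.reverse.length) y
  rw [← L.length_reverse, h2]
  simpa only [List.ofFn_get, List.reverse_reverse] using h

theorem L2_DAbs_le (hu : SmoothPer u) {ℓ : ℕ} {B : ℝ}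
    (hB : ∀ L : List (Fin n × Fin d), L.length = ℓ → L2 (iterD L u) ≤ B) :
    L2 (DAbs ℓ u) ≤ (n * d : ℝ) ^ ℓ * B := by
  rw [DAbs_eq_sum hu]
  refine (L2_sum_le _ fun idx _ => (hu.iterD _).continuous.abs).trans ?_
  refine (Finset.sum_le_sum fun idx _ => (?_ : _ ≤ B)).trans_eq ?_
  · rw [L2_abs]
    exact hB _ (by simp)
  · simp

end IteratedDerivative

section Leibniz

open Finset

/-- Binomial convolution of two sequences. -/
def binomConv (α β : ℕ → ℝ) (ℓ : ℕ) : ℝ :=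
  ∑ ij ∈ antidiagonal ℓ, (ℓ.choose ij.1 : ℝ) * (α ij.1 * β ij.2)

theorem binomConv_zero (α β : ℕ → ℝ) : binomConv α β 0 = α 0 * β 0 := by simp [binomConv]

theorem binomConv_succ (α β : ℕ → ℝ) (ℓ : ℕ) :
    binomConv α β (ℓ + 1) =
      binomConv (fun i => α (i + 1)) β ℓ + binomConv α (fun j => β (j + 1)) ℓ := by
  rw [binomConv, sum_antidiagonal_choose_succ_mul (fun i j => α i * β j), add_comm]
  congr 1
  refine sum_congr rfl fun ij hij => ?_
  rw [Nat.choose_symm_of_eq_add (mem_antidiagonal.1 hij).symm]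

variable {d n : ℕ} {a b : Dom d n → ℝ}

theorem iterD_cons_mul (p : Fin n × Fin d) (L : List (Fin n × Fin d)) (ha : SmoothPer a)
    (hb : SmoothPer b) : iterD (p :: L) (fun y => a y * b y) = fun y =>
      iterD L (fun y => pd p.1 p.2 a y * b y) y + iterD L (fun y => a y * pd p.1 p.2 b y) y := by
  rw [iterD, pd_mul _ _ ha hb,
    iterD_add L ((ha.pd _ _).mul hb) (ha.mul (hb.pd _ _))]

theorem L2_iterD_mul_le (ha : SmoothPer a) (hb : SmoothPer b) {α β : ℕ → ℝ}
    (L : List (Fin n × Fin d)) (hα : ∀ (L' : List (Fin n × Fin d)) y, |iterD L' a y| ≤ α L'.length)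
    (hβ : ∀ L' : List (Fin n × Fin d), L'.length ≤ L.length → L2 (iterD L' b) ≤ β L'.length) :
    L2 (iterD L fun y => a y * b y) ≤ binomConv α β L.length := by
  induction L generalizing a b α β with
  | nil =>
    have h0 : 0 ≤ α 0 := (abs_nonneg _).trans (hα [] 0)
    rw [List.length_nil, binomConv_zero]
    refine (L2_le_mul_of_abs_le h0 (ha.mul hb).continuous hb.continuous fun y => ?_).trans
      (mul_le_mul_of_nonneg_left (hβ [] le_rfl) h0)
    rw [abs_mul]
    exact mul_le_mul_of_nonneg_right (hα [] y) (abs_nonneg _)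
  | cons p L ih =>
    rw [iterD_cons_mul p L ha hb, List.length_cons, binomConv_succ]
    refine (L2_add_le (((ha.pd _ _).mul hb).iterD L).continuous
      ((ha.mul (hb.pd _ _)).iterD L).continuous).trans (add_le_add ?_ ?_)
    · exact ih (ha.pd _ _) hb (fun L' y => hα (p :: L') y)
        fun L' hL' => hβ L' (hL'.trans (Nat.le_succ _))
    · exact ih ha (hb.pd _ _) hα fun L' hL' => hβ (p :: L') (Nat.succ_le_succ hL')

/-- Bound of the commutator of an iterated derivative and a multiplication. -/
theorem L2_iterD_commutator_le (ha : SmoothPer a) (hb : SmoothPer b) {α β : ℕ → ℝ}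
    (L : List (Fin n × Fin d)) (h0 : α 0 = 0)
    (hα : ∀ (L' : List (Fin n × Fin d)) y, L' ≠ [] → |iterD L' a y| ≤ α L'.length)
    (hβ : ∀ L' : List (Fin n × Fin d), L'.length < L.length → L2 (iterD L' b) ≤ β L'.length) :
    L2 (fun y => iterD L (fun y => a y * b y) y - a y * iterD L b y) ≤
      binomConv α β L.length := by
  induction L generalizing b β with
  | nil => simp [iterD, L2_zero, binomConv_zero, h0]
  | cons p L ih =>
    have hrw : (fun y => iterD (p :: L) (fun y => a y * b y) y - a y * iterD (p :: L) b y) =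
        fun y => iterD L (fun y => pd p.1 p.2 a y * b y) y +
          (iterD L (fun y => a y * pd p.1 p.2 b y) y - a y * iterD L (pd p.1 p.2 b) y) := by
      funext y
      rw [iterD_cons_mul p L ha hb, iterD]
      ring
    rw [hrw, List.length_cons, binomConv_succ]
    have hb' := hb.pd p.1 p.2
    refine (L2_add_le (((ha.pd _ _).mul hb).iterD L).continuous
      (((ha.mul hb').iterD L).sub (ha.mul (hb'.iterD L))).continuous).trans (add_le_add ?_ ?_)
    · exact L2_iterD_mul_le (ha.pd _ _) hb L (fun L' y => hα (p :: L') y (by simp))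
        fun L' hL' => hβ L' (Nat.lt_succ_of_le hL')
    · exact ih hb' fun L' hL' => hβ (p :: L') (Nat.succ_lt_succ hL')

theorem choose_mul_factorial_mul_factorial_add_le (i j q : ℕ) :
    (i + j).choose i * i.factorial * (j + q).factorial ≤ (i + j + q).factorial := by
  have h := Nat.add_choose_mul_factorial_mul_factorial i (j + q)
  rw [← Nat.choose_symm_add, ← add_assoc] at h
  rw [← h]
  exact Nat.mul_le_mul_right _ (Nat.mul_le_mul_right _ (Nat.choose_le_choose i (by omega)))

theorem binomConv_analytic_le {C₀ Λ₀ K Λ : ℝ} (hC₀ : 0 ≤ C₀) (hΛ₀ : 0 ≤ Λ₀) (hK : 0 ≤ K)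
    (hΛ : 0 < Λ) (hΛ₀Λ : 2 * Λ₀ ≤ Λ) (q ℓ : ℕ) :
    binomConv (fun i => if i = 0 then 0 else C₀ * Λ₀ ^ i * (i.factorial : ℝ))
      (fun j => K * Λ ^ j * ((j + q).factorial : ℝ)) ℓ ≤
      2 * (C₀ * (Λ₀ / Λ)) * (K * Λ ^ ℓ * ((ℓ + q).factorial : ℝ)) := by
  set ρ := Λ₀ / Λ with hρ
  have hρ0 : 0 ≤ ρ := div_nonneg hΛ₀ hΛ.le
  have hρ1 : ρ ≤ 1 / 2 := by
    rw [hρ, div_le_iff₀ hΛ]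
    linarith
  have hΛ₀eq : Λ₀ = ρ * Λ := by rw [hρ, div_mul_cancel₀ _ hΛ.ne']
  calc _ ≤ ∑ ij ∈ antidiagonal ℓ, C₀ * (K * Λ ^ ℓ * ((ℓ + q).factorial : ℝ)) *
        (if ij.1 = 0 then 0 else ρ ^ ij.1) := by
        refine sum_le_sum fun ij hij => ?_
        obtain ⟨i, j⟩ := ij
        obtain rfl := mem_antidiagonal.1 hij
        by_cases hi : i = 0
        · simp [hi]
        · have h : (((i + j).choose i * i.factorial * (j + q).factorial : ℕ) : ℝ) ≤
              ((i + j + q).factorial : ℕ) := by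
            exact_mod_cast choose_mul_factorial_mul_factorial_add_le i j q
          push_cast at h
          simp only [hi, if_false]
          calc _ = C₀ * (K * Λ ^ (i + j)) * ρ ^ i *
                (((i + j).choose i : ℝ) * i.factorial * (j + q).factorial) := by
                rw [hΛ₀eq, mul_pow, pow_add]
                ring
            _ ≤ C₀ * (K * Λ ^ (i + j)) * ρ ^ i * (i + j + q).factorial := by gcongr
            _ = _ := by ring
    _ = C₀ * (K * Λ ^ ℓ * ((ℓ + q).factorial : ℝ)) * (ρ * ∑ i ∈ range ℓ, ρ ^ i) := by
        rw [← mul_sum, Nat.sum_antidiagonal_eq_sum_range_succ_mk, sum_range_succ', mul_sum]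
        simp [pow_succ']
    _ ≤ C₀ * (K * Λ ^ ℓ * ((ℓ + q).factorial : ℝ)) * (ρ * 2) := by
        gcongr
        exact (sum_le_sum fun i _ => by gcongr).trans (sum_geometric_two_le ℓ)
    _ = _ := by ring

end Leibniz

section Estimates

variable {d n : ℕ}

theorem setIntegral_iterD_eq_zero {u : Dom d n → ℝ} (hu : SmoothPer u)
    (h0 : ∫ y in cell d n, u y = 0) (L : List (Fin n × Fin d)) :
    ∫ y in cell d n, iterD L u y = 0 := by
  cases L with
  | nil => exact h0
  | cons p L =>
    rw [iterD, iterD_pd L _ _ hu]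
    exact setIntegral_fderiv_eq_zero (hu.iterD L) _

variable {lam τ C₀ Λ₀ Λ₁ Λ : ℝ} {q : ℕ} {δ : Fin n → ℝ} {A : Dom d n → Fin d → Fin d → ℝ}
  {F : Fin d → Dom d n → ℝ} {Y : Dom d n → ℝ}

theorem setIntegral_corrector_eq_zero (hτ : 0 < τ) (hA : ∀ k l, SmoothPer fun y => A y k l)
    (hF : ∀ k, SmoothPer (F k)) (hY : SmoothPer Y)
    (heq : ∀ y, -(∑ k, gradHatC δ n k (fun y' => ∑ l, A y' k l * gradHatC δ n l Y y') y)
      + τ ^ 2 * Y y = ∑ k, gradHatC δ n k (F k) y) :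
    ∫ y in cell d n, Y y = 0 := by
  have hdiv : ∀ Q : Fin d → Dom d n → ℝ, (∀ k, SmoothPer (Q k)) →
      ∫ y in cell d n, ∑ k, gradHatC δ n k (Q k) y = 0 := by
    intro Q hQ
    rw [integral_finsetSum _ fun k _ => integrableOn_cell ((hQ k).gradHatC δ n k).continuous]
    exact Finset.sum_eq_zero fun k _ => setIntegral_gradHatC δ k (hQ k)
  have hP : ∀ k, SmoothPer fun y => ∑ l, A y k l * gradHatC δ n l Y y := fun k =>
    SmoothPer.sum fun l _ => (hA k l).mul (hY.gradHatC δ n l)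
  have hS := (SmoothPer.sum fun k (_ : k ∈ Finset.univ) => (hP k).gradHatC δ n k).continuous
  have h := hdiv F hF
  simp only [← heq] at h
  rw [integral_add (integrableOn_cell (by fun_prop))
    (integrableOn_cell (hY.const_mul _).continuous), integral_neg, hdiv _ hP,
    integral_const_mul] at h
  have : τ ^ 2 ≠ 0 := by positivity
  simpa [this] using h

theorem iterD_corrector_eq (hA : ∀ k l, SmoothPer fun y => A y k l)
    (hF : ∀ k, SmoothPer (F k)) (hY : SmoothPer Y)
    (heq : ∀ y, -(∑ k, gradHatC δ n k (fun y' => ∑ l, A y' k l * gradHatC δ n l Y y') y)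
      + τ ^ 2 * Y y = ∑ k, gradHatC δ n k (F k) y) (L : List (Fin n × Fin d)) (y : Dom d n) :
    -(∑ k, gradHatC δ n k (fun y' => ∑ l, A y' k l * gradHatC δ n l (iterD L Y) y') y)
      + τ ^ 2 * iterD L Y y = ∑ k, gradHatC δ n k (fun y => iterD L (F k) y +
        ∑ l, (iterD L (fun y => A y k l * gradHatC δ n l Y y) y -
          A y k l * iterD L (gradHatC δ n l Y) y)) y := by
  have hg : ∀ l, SmoothPer (gradHatC δ n l Y) := fun l => hY.gradHatC δ n l
  have hAg : ∀ k l, SmoothPer fun y => A y k l * gradHatC δ n l Y y := fun k l =>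
    (hA k l).mul (hg l)
  have hP : ∀ k, SmoothPer fun y => ∑ l, A y k l * gradHatC δ n l Y y := fun k =>
    SmoothPer.sum fun l _ => hAg k l
  have hdiv : ∀ Q : Fin d → Dom d n → ℝ, (∀ k, SmoothPer (Q k)) →
      iterD L (fun y => ∑ k, gradHatC δ n k (Q k) y) =
        fun y => ∑ k, gradHatC δ n k (iterD L (Q k)) y := by
    intro Q hQ
    rw [iterD_sum L _ fun k => (hQ k).gradHatC δ n k]
    simp only [iterD_gradHatC L δ _ (hQ _)]
  have hcomm : ∀ k l, SmoothPer fun y => iterD L (fun y => A y k l * gradHatC δ n l Y y) y -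
      A y k l * iterD L (gradHatC δ n l Y) y := fun k l =>
    ((hAg k l).iterD L).sub ((hA k l).mul ((hg l).iterD L))
  have hmain : -(∑ k, gradHatC δ n k
        (iterD L fun y => ∑ l, A y k l * gradHatC δ n l Y y) y) + τ ^ 2 * iterD L Y y =
      ∑ k, gradHatC δ n k (iterD L (F k)) y := by
    have h := congrArg (iterD L) (funext heq)
    rw [hdiv F hF] at h
    rw [← congrFun h y]
    have h1 := (SmoothPer.sum (s := Finset.univ)
      fun k _ => (hP k).gradHatC δ n k).const_mul (-1)
    have h2 := iterD_add L h1 (hY.const_mul (τ ^ 2))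
    rw [iterD_const_mul L _ hY, iterD_const_mul L _
      (SmoothPer.sum fun k _ => (hP k).gradHatC δ n k), hdiv _ hP] at h2
    simp only [neg_one_mul] at h2
    rw [h2]
  have hsplit : ∀ k, gradHatC δ n k (iterD L fun y => ∑ l, A y k l * gradHatC δ n l Y y) y =
      gradHatC δ n k (fun y' => ∑ l, A y' k l * gradHatC δ n l (iterD L Y) y') y +
      gradHatC δ n k (fun y => ∑ l, (iterD L (fun y => A y k l * gradHatC δ n l Y y) y -
          A y k l * iterD L (gradHatC δ n l Y) y)) y := by
    intro k
    have h := congrFun (gradHatC_add δ k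
      (SmoothPer.sum (s := Finset.univ) fun l _ =>
        (hA k l).mul ((hY.iterD L).gradHatC δ n l))
      (SmoothPer.sum (s := Finset.univ) fun l _ => hcomm k l)) y
    rw [← h, iterD_sum L _ (hAg k)]
    congr 1
    funext y
    rw [← Finset.sum_add_distrib]
    refine Finset.sum_congr rfl fun l _ => ?_
    rw [iterD_gradHatC L δ l hY]
    ring
  have hadd : ∀ k, gradHatC δ n k (fun y => iterD L (F k) y +
        ∑ l, (iterD L (fun y => A y k l * gradHatC δ n l Y y) y -
          A y k l * iterD L (gradHatC δ n l Y) y)) y =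
      gradHatC δ n k (iterD L (F k)) y + gradHatC δ n k (fun y =>
        ∑ l, (iterD L (fun y => A y k l * gradHatC δ n l Y y) y -
          A y k l * iterD L (gradHatC δ n l Y) y)) y := fun k =>
    congrFun (gradHatC_add δ k ((hF k).iterD L) (SmoothPer.sum fun l _ => hcomm k l)) y
  simp only [hadd, Finset.sum_add_distrib]
  simp only [hsplit, Finset.sum_add_distrib] at hmain
  linarith

/-- Analytic bounds for the directional gradient of the corrector. -/
theorem L2_gradHatC_iterD_le (hlam : lam ∈ Set.Ioc (0 : ℝ) 1) (hC₀ : 1 ≤ C₀) (hΛ₀ : 0 < Λ₀)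
    (hΛ₁ : 0 < Λ₁) (hΛ₁Λ : Λ₁ ≤ Λ) (hΛ₀Λ : 2 * Λ₀ ≤ Λ)
    (hΛ : 4 * (d : ℝ) ^ 2 * C₀ * Λ₀ ≤ lam * Λ)
    (hA : ∀ k l, SmoothPer fun y => A y k l) (hell : Elliptic lam A)
    (hAb : ∀ k l (L : List (Fin n × Fin d)) y,
      |iterD L (fun y => A y k l) y| ≤ C₀ * Λ₀ ^ L.length * (L.length.factorial : ℝ))
    (hF : ∀ k, SmoothPer (F k))
    (hFb : ∀ k (L : List (Fin n × Fin d)),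
      L2 (iterD L (F k)) ≤ Λ₁ ^ L.length * ((L.length + q).factorial : ℝ))
    (hY : SmoothPer Y)
    (heq : ∀ y, -(∑ k, gradHatC δ n k (fun y' => ∑ l, A y' k l * gradHatC δ n l Y y') y)
      + τ ^ 2 * Y y = ∑ k, gradHatC δ n k (F k) y) (L : List (Fin n × Fin d)) :
    (∀ k, L2 (gradHatC δ n k (iterD L Y)) ≤
      2 * d / lam * Λ ^ L.length * ((L.length + q).factorial : ℝ)) ∧
    τ * L2 (iterD L Y) ≤ 2 * d / lam * Λ ^ L.length * ((L.length + q).factorial : ℝ) := by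
  have hl0 := hlam.1
  have hΛpos : 0 < Λ := hΛ₁.trans_le hΛ₁Λ
  have hg : ∀ l, SmoothPer (gradHatC δ n l Y) := fun l => hY.gradHatC δ n l
  have hcomm : ∀ (L : List (Fin n × Fin d)) k l,
      SmoothPer fun y => iterD L (fun y => A y k l * gradHatC δ n l Y y) y -
        A y k l * iterD L (gradHatC δ n l Y) y := fun L k l =>
    (((hA k l).mul (hg l)).iterD L).sub ((hA k l).mul ((hg l).iterD L))
  induction hℓ : L.length using Nat.strong_induction_on generalizing L with
  | _ ℓ ih =>
  subst hℓ
  set K : ℝ := 2 * d / lam with hK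
  have hK0 : 0 ≤ K := by positivity
  set E := Λ ^ L.length * ((L.length + q).factorial : ℝ) with hE
  have hE0 : 0 ≤ E := by positivity
  have hcb : ∀ k l, L2 (fun y => iterD L (fun y => A y k l * gradHatC δ n l Y y) y -
        A y k l * iterD L (gradHatC δ n l Y) y) ≤ 2 * (C₀ * (Λ₀ / Λ)) * (K * E) := by
    intro k l
    rw [hE, ← mul_assoc K]
    refine (L2_iterD_commutator_le (hA k l) (hg l)
      (α := fun i => if i = 0 then 0 else C₀ * Λ₀ ^ i * (i.factorial : ℝ))
      (β := fun j => K * Λ ^ j * ((j + q).factorial : ℝ)) L (by simp) (fun L' y hL' => ?_)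
      fun L' hL' => ?_).trans (binomConv_analytic_le (by positivity) hΛ₀.le hK0 hΛpos hΛ₀Λ q _)
    · simpa [hL'] using hAb k l L' y
    · rw [iterD_gradHatC L' δ l hY]
      exact (ih _ hL' L' rfl).1 l
  have hGb : ∀ k, L2 (fun y => iterD L (F k) y +
        ∑ l, (iterD L (fun y => A y k l * gradHatC δ n l Y y) y -
          A y k l * iterD L (gradHatC δ n l Y) y)) ≤
      E + d * (2 * (C₀ * (Λ₀ / Λ)) * (K * E)) := by
    intro k
    refine (L2_add_le ((hF k).iterD L).continuous
      (SmoothPer.sum fun l _ => hcomm L k l).continuous).trans (add_le_add ?_ ?_)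
    · refine (hFb k L).trans ?_
      rw [hE]
      gcongr
    · refine (L2_sum_le _ fun l _ => (hcomm L k l).continuous).trans ?_
      refine (Finset.sum_le_sum fun l _ => hcb k l).trans_eq ?_
      simp
  have hfinal : lam⁻¹ * ∑ k, L2 (fun y => iterD L (F k) y +
        ∑ l, (iterD L (fun y => A y k l * gradHatC δ n l Y y) y -
          A y k l * iterD L (gradHatC δ n l Y) y)) ≤ K * E := by
    calc _ ≤ lam⁻¹ * ∑ _k : Fin d, (E + d * (2 * (C₀ * (Λ₀ / Λ)) * (K * E))) := by
          gcongr with k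
          exact hGb k
      _ = K * E * (1 / 2 + 2 * (d : ℝ) ^ 2 * C₀ * Λ₀ / (lam * Λ)) := by
          rw [Finset.sum_const, Finset.card_univ, Fintype.card_fin, nsmul_eq_mul, hK]
          field_simp
      _ ≤ K * E * (1 / 2 + 1 / 2) := by
          gcongr ?_ * (_ + ?_)
          rw [div_le_iff₀ (by positivity)]
          linarith
      _ = K * E := by ring
  rw [mul_assoc K, ← hE]
  have := energy_estimate hlam δ hA hell (hY.iterD L)
    (fun k => ((hF k).iterD L).add (SmoothPer.sum fun l _ => hcomm L k l))
    (iterD_corrector_eq hA hF hY heq L)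
  exact ⟨fun k => (this.1 k).trans hfinal, this.2.trans hfinal⟩

/-- Removal of the factor `τ⁻¹` by iterating the Poincaré inequality `k` times. -/
theorem L2_iterD_le_of_separated {ε K : ℝ} (hd : 1 ≤ d) (hn : 1 ≤ n) (hτ : 0 < τ)
    (hpos : ∀ i, 0 < δ i) (hle : ∀ i, δ i ≤ 1)
    (hε0 : 0 ≤ ε) (hε : ∀ i j, i < j → δ j ≤ ε * δ i) (hK : 0 ≤ K) (hΛ : 0 ≤ Λ)
    (hY : SmoothPer Y) (h0 : ∫ y in cell d n, Y y = 0)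
    (hg : ∀ (L : List (Fin n × Fin d)) k, L2 (gradHatC δ n k (iterD L Y)) ≤
      K * Λ ^ L.length * ((L.length + q).factorial : ℝ))
    (hgτ : ∀ L : List (Fin n × Fin d), τ * L2 (iterD L Y) ≤
      K * Λ ^ L.length * ((L.length + q).factorial : ℝ))
    {ℓ k : ℕ} (hsep : ε * ((n : ℝ) ^ 2 * d * Λ) * (ℓ + k + q) ≤ (Real.exp 1)⁻¹)
    (hk : Real.exp (-(k : ℝ)) ≤ τ) (L : List (Fin n × Fin d)) (hL : L.length = ℓ) :
    L2 (iterD L Y) ≤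
      K * (2 * ((n : ℝ) ^ 2 * d) + 1) * Λ ^ ℓ * ((ℓ + q).factorial : ℝ) := by
  set c : ℝ := (n : ℝ) ^ 2 * d with hc
  have hn1 : (1 : ℝ) ≤ n := by exact_mod_cast hn
  have hc0 : 0 ≤ c := by positivity
  have hexp : (Real.exp 1)⁻¹ ≤ 1 / 2 := by
    rw [one_div]
    gcongr
    linarith [Real.add_one_le_exp (1 : ℝ)]
  have key : ∀ p : ℕ, p ≤ k → ∀ L : List (Fin n × Fin d), L.length + p = ℓ + k →
      L2 (iterD L Y) ≤ K * Λ ^ L.length * ((L.length + q).factorial : ℝ) *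
        (2 * c + (Real.exp 1)⁻¹ ^ p * τ⁻¹) := by
    intro p
    induction p with
    | zero =>
      intro _ L _
      have h1 : L2 (iterD L Y) ≤
          K * Λ ^ L.length * ((L.length + q).factorial : ℝ) * τ⁻¹ := by
        rw [← div_eq_mul_inv, le_div_iff₀ hτ, mul_comm]
        exact hgτ L
      refine h1.trans (mul_le_mul_of_nonneg_left ?_ (by positivity))
      simpa using hc0
    | succ p ih =>
      intro hp L hLp
      set m := L.length with hm
      set X := 2 * c + (Real.exp 1)⁻¹ ^ p * τ⁻¹ with hX
      have hX0 : 0 ≤ X := by positivity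
      set E := K * Λ ^ m * ((m + q).factorial : ℝ) with hE
      have hE0 : 0 ≤ E := by positivity
      have hpd : ∀ i k, L2 (pd i k (iterD L Y)) ≤ E * (Λ * (m + 1 + q)) * X := by
        intro i k
        have h := ih (by omega) ((i, k) :: L) (by simp only [List.length_cons]; omega)
        rw [iterD, iterD_pd L i k hY] at h
        refine h.trans_eq ?_
        rw [List.length_cons, ← hm, add_right_comm, Nat.factorial_succ, hE]
        push_cast
        ring
      have hmk : ((m : ℝ) + 1 + q) ≤ ℓ + k + q := by
        have : m + 1 ≤ ℓ + k := by omega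
        have : ((m : ℝ) + 1) ≤ ℓ + k := by exact_mod_cast this
        linarith
      calc L2 (iterD L Y)
          ≤ n * ∑ k, L2 (gradHatC δ n k (iterD L Y)) +
            n * ε * ∑ i, ∑ k, L2 (pd i k (iterD L Y)) :=
            L2_le_gradHat hpos hle hε0 hε (hY.iterD L) (setIntegral_iterD_eq_zero hY h0 L)
        _ ≤ n * ∑ _k : Fin d, E +
            n * ε * ∑ _i : Fin n, ∑ _k : Fin d, E * (Λ * (m + 1 + q)) * X := by
            gcongr with k _ i _ k _
            · exact hg L k
            · exact hpd i k
        _ = (n * d) * E + E * (ε * (c * Λ) * (m + 1 + q)) * X := by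
            simp only [Finset.sum_const, Finset.card_univ, Fintype.card_fin, nsmul_eq_mul, hc]
            ring
        _ ≤ c * E + E * (Real.exp 1)⁻¹ * X := by
            gcongr
            · rw [hc]
              gcongr
              nlinarith
            · exact le_trans (by gcongr) hsep
        _ = E * (c + (Real.exp 1)⁻¹ * (2 * c) + (Real.exp 1)⁻¹ ^ (p + 1) * τ⁻¹) := by
            rw [hX]
            ring
        _ ≤ E * (2 * c + (Real.exp 1)⁻¹ ^ (p + 1) * τ⁻¹) := by
            gcongr
            nlinarith
  have h := key k le_rfl L (by omega)
  rw [hL] at h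
  refine h.trans ?_
  have hlast : (Real.exp 1)⁻¹ ^ k * τ⁻¹ ≤ 1 := by
    rw [← div_eq_mul_inv, div_le_one hτ, ← Real.exp_neg, ← Real.exp_nat_mul]
    simpa using hk
  calc _ ≤ K * Λ ^ ℓ * ((ℓ + q).factorial : ℝ) * (2 * c + 1) := by gcongr
    _ = _ := by ring

/-- The largest ratio of consecutive scales controls all ratios. -/
theorem exists_max_ratio (hn : 2 ≤ n) (hpos : ∀ i, 0 < δ i) (hδ : ∀ i j : Fin n, i < j → δ j < δ i) :
    ∃ a : ℕ, ∃ ha : a + 1 < n, ∀ i j : Fin n, i < j →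
      δ j ≤ δ ⟨a + 1, ha⟩ / δ ⟨a, by omega⟩ * δ i := by
  have : Nonempty (Fin (n - 1)) := ⟨⟨0, by omega⟩⟩
  obtain ⟨⟨a, ha⟩, hmax⟩ := Finite.exists_max fun i : Fin (n - 1) =>
    δ ⟨i + 1, by omega⟩ / δ ⟨i, by omega⟩
  refine ⟨a, by omega, fun i j hij => ?_⟩
  obtain ⟨j, hj⟩ := j
  obtain ⟨b, rfl⟩ : ∃ b, j = b + 1 := ⟨j - 1, by have := Fin.lt_def.1 hij; simp only at this; omega⟩
  have h1 := hmax ⟨b, by omega⟩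
  have hb : 0 < δ ⟨b, by omega⟩ := hpos _
  have h2 : δ ⟨b, by omega⟩ ≤ δ i := by
    rcases (Nat.lt_succ_iff.1 (Fin.lt_def.1 hij)).lt_or_eq with h | h
    · exact (hδ i ⟨b, by omega⟩ h).le
    · exact (congrArg δ (Fin.ext h)).ge
  rw [div_le_iff₀ hb] at h1
  exact h1.trans (mul_le_mul_of_nonneg_left h2 (div_pos (hpos _) (hpos _)).le)

end Estimates

/-- Theorem 3.4: uniform n-scale estimate for the regularized corrector equation. -/
theorem statement3 (d n : ℕ) (hd : 1 ≤ d) (hn : 2 ≤ n) (lam C₀ Λ₀ Λ₁ : ℝ)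
    (hlam : lam ∈ Set.Ioc (0 : ℝ) 1) (hC₀ : 1 ≤ C₀) (hΛ₀ : 0 < Λ₀) (hΛ₁ : 0 < Λ₁) :
    ∃ (Ct Λt : ℕ → ℝ) (Cn Λn : ℝ),
      (∀ j : ℕ, 2 ≤ j → j ≤ n → 1 ≤ Ct j) ∧ (∀ j : ℕ, 2 ≤ j → j ≤ n → 1 ≤ Λt j) ∧
      1 ≤ Cn ∧ 1 ≤ Λn ∧
      ∀ (q : ℕ) (τ : ℝ), τ ∈ Set.Ioc (0 : ℝ) 1 →
      ∀ (δ : Fin n → ℝ), δ ⟨0, by omega⟩ = 1 → (∀ i, 0 < δ i) →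
        (∀ i j : Fin n, i < j → δ j < δ i) →
      ∀ (A : Dom d n → Fin d → Fin d → ℝ) (F : Dom d n → Fin d → ℝ) (Y : Dom d n → ℝ),
        (∀ k l, ContDiff ℝ (⊤ : ℕ∞) fun y => A y k l) →
        (∀ k l, MPeriodic fun y => A y k l) →
        Elliptic lam A →
        (∀ (ℓ : ℕ) (y : Dom d n),
          (∑ k, ∑ l, DAbs ℓ (fun y' => A y' k l) y) ≤ C₀ * Λ₀ ^ ℓ * (Nat.factorial ℓ : ℝ)) →
        (∀ k, ContDiff ℝ (⊤ : ℕ∞) fun y => F y k) → (∀ k, MPeriodic fun y => F y k) →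
        (∀ ℓ : ℕ, L2 (fun y => ∑ k, DAbs ℓ (fun y' => F y' k) y)
            ≤ Λ₁ ^ ℓ * (Nat.factorial (ℓ + q) : ℝ)) →
        ContDiff ℝ (⊤ : ℕ∞) Y → MPeriodic Y →
        (∀ y : Dom d n,
          -(∑ k, gradHatC δ n k (fun y' => ∑ l, A y' k l * gradHatC δ n l Y y') y)
              + τ ^ 2 * Y y
            = ∑ k, gradHatC δ n k (fun y' => F y' k) y) →
        ∀ ℓ : ℕ,
          (∀ j : ℕ, (hj2 : 2 ≤ j) → (hjn : j ≤ n) →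
            ∃ kj : ℕ, 1 ≤ kj ∧
              (δ ⟨j - 1, by omega⟩ / δ ⟨j - 2, by omega⟩) * (Ct j) ^ 3 * Λt j
                  * ((ℓ : ℝ) + kj + q) ≤ (Real.exp 1)⁻¹ ∧
              (Ct j) ^ 3 * Λt j * (δ ⟨j - 2, by omega⟩)⁻¹ * Real.exp (-(kj : ℝ) + 1) ≤ τ ^ 2) →
          L2 (DAbs ℓ Y) ≤ Cn * Λn ^ ℓ * (Nat.factorial (ℓ + 1 + q) : ℝ) := by
  have hl0 := hlam.1
  have hd1 : (1 : ℝ) ≤ d := by exact_mod_cast hd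
  have hn1 : (1 : ℝ) ≤ n := by exact_mod_cast (by omega : 1 ≤ n)
  set Λ : ℝ := 1 + Λ₁ + 2 * Λ₀ + 4 * (d : ℝ) ^ 2 * C₀ * Λ₀ / lam with hΛ
  have hpos4 : 0 < 4 * (d : ℝ) ^ 2 * C₀ * Λ₀ / lam := by positivity
  have hΛ1 : 1 ≤ Λ := by linarith
  have hlamΛ : 4 * (d : ℝ) ^ 2 * C₀ * Λ₀ ≤ lam * Λ := by
    rw [← div_le_iff₀' hl0]
    linarith
  set c : ℝ := (n : ℝ) ^ 2 * d with hc
  have hc1 : 1 ≤ c := one_le_mul_of_one_le_of_one_le (one_le_pow₀ hn1) hd1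
  have hK1 : 1 ≤ 2 * (d : ℝ) / lam := by
    rw [le_div_iff₀ hl0]
    linarith [hlam.2]
  have hcΛ : 1 ≤ c * Λ := one_le_mul_of_one_le_of_one_le hc1 hΛ1
  refine ⟨fun _ => 1, fun _ => c * Λ, 2 * d / lam * (2 * c + 1), n * d * Λ, fun _ _ _ => le_rfl,
    fun _ _ _ => hcΛ, one_le_mul_of_one_le_of_one_le hK1 (by linarith),
    one_le_mul_of_one_le_of_one_le (one_le_mul_of_one_le_of_one_le hn1 hd1) hΛ1, ?_⟩
  intro q τ hτ δ hδ0 hpos hδ A F Y hAs hAp hell hAb hFs hFp hFb hYs hYp heq ℓ hsep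
  have hA : ∀ k l, SmoothPer fun y => A y k l := fun k l => ⟨hAs k l, hAp k l⟩
  have hF : ∀ k, SmoothPer fun y => F y k := fun k => ⟨hFs k, hFp k⟩
  have hY : SmoothPer Y := ⟨hYs, hYp⟩
  have hle : ∀ i, δ i ≤ 1 := by
    intro i
    rw [← hδ0]
    rcases (Nat.zero_le (i : ℕ)).eq_or_lt with h | h
    · exact (congrArg δ (Fin.ext h.symm)).le
    · exact (hδ ⟨0, by omega⟩ i h).le
  have hAb' : ∀ k l (L : List (Fin n × Fin d)) y,
      |iterD L (fun y => A y k l) y| ≤ C₀ * Λ₀ ^ L.length * (L.length.factorial : ℝ) := by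
    intro k l L y
    refine (abs_iterD_le_DAbs (hA k l) L y).trans (le_trans ?_ (hAb L.length y))
    exact (Finset.single_le_sum (f := fun l => DAbs L.length (fun y' => A y' k l) y)
      (fun _ _ => DAbs_nonneg _ _ _) (Finset.mem_univ l)).trans
      (Finset.single_le_sum (f := fun k => ∑ l, DAbs L.length (fun y' => A y' k l) y)
        (fun _ _ => Finset.sum_nonneg fun _ _ => DAbs_nonneg _ _ _) (Finset.mem_univ k))
  have hFb' : ∀ k (L : List (Fin n × Fin d)),
      L2 (iterD L fun y => F y k) ≤ Λ₁ ^ L.length * ((L.length + q).factorial : ℝ) := by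
    intro k L
    refine (L2_mono ((hF k).iterD L).continuous
      (continuous_finsetSum _ fun k _ => continuous_DAbs (hF k) L.length) fun y => ?_).trans
      (hFb L.length)
    refine (abs_iterD_le_DAbs (hF k) L y).trans (le_trans ?_ (le_abs_self _))
    exact Finset.single_le_sum (f := fun k => DAbs L.length (fun y' => F y' k) y)
      (fun _ _ => DAbs_nonneg _ _ _) (Finset.mem_univ k)
  have hgrad := L2_gradHatC_iterD_le (F := fun k y => F y k) hlam hC₀ hΛ₀ hΛ₁
    (Λ := Λ) (by linarith) (by linarith) hlamΛ hA hell hAb' hF hFb' hY heq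
  have h0 := setIntegral_corrector_eq_zero (F := fun k y => F y k) hτ.1 hA hF hY heq
  obtain ⟨a, ha, hmax⟩ := exists_max_ratio hn hpos hδ
  obtain ⟨k, -, hk1, hk2⟩ := hsep (a + 2) (by omega) (by omega)
  have hk1' : δ ⟨a + 1, ha⟩ / δ ⟨a, by omega⟩ * (c * Λ) * ((ℓ : ℝ) + k + q) ≤
      (Real.exp 1)⁻¹ := by
    simpa using hk1
  have hk2' : c * Λ * (δ ⟨a, by omega⟩)⁻¹ * Real.exp (-(k : ℝ) + 1) ≤ τ ^ 2 := by
    simpa using hk2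
  have hkτ : Real.exp (-(k : ℝ)) ≤ τ := by
    have h1 : 1 ≤ c * Λ * (δ ⟨a, by omega⟩)⁻¹ :=
      one_le_mul_of_one_le_of_one_le hcΛ ((one_le_inv₀ (hpos _)).2 (hle _))
    calc Real.exp (-(k : ℝ)) ≤ Real.exp (-(k : ℝ) + 1) := Real.exp_le_exp.2 (by linarith)
      _ ≤ c * Λ * (δ ⟨a, by omega⟩)⁻¹ * Real.exp (-(k : ℝ) + 1) :=
          le_mul_of_one_le_left (Real.exp_pos _).le h1
      _ ≤ τ ^ 2 := hk2'
      _ ≤ τ := pow_le_of_le_one hτ.1.le hτ.2 two_ne_zero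
  have hmain := L2_DAbs_le hY (ℓ := ℓ) fun L hL =>
    L2_iterD_le_of_separated hd (by omega) hτ.1 hpos hle (div_pos (hpos _) (hpos _)).le hmax
      (zero_le_one.trans hK1) (zero_le_one.trans hΛ1) hY h0 (fun L => (hgrad L).1)
      (fun L => (hgrad L).2) hk1' hkτ L hL
  refine hmain.trans ?_
  have hfac : ((ℓ + q).factorial : ℝ) ≤ ((ℓ + 1 + q).factorial : ℝ) := by
    exact_mod_cast Nat.factorial_le (by omega)
  calc _ = 2 * d / lam * (2 * c + 1) * (n * d * Λ) ^ ℓ * ((ℓ + q).factorial : ℝ) := by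
        rw [mul_pow _ Λ]
        ring
    _ ≤ _ := by gcongr

end MS
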